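/- Let r₀ : ℝ → ℝ be C¹, bounded, with bounded derivative, such that r₀(+∞) := lim_{x→+∞} r₀(x) exists and is finite, and let α ∈ ℝ satisfy both r₀'(α)·( r₀(α) + r₀(+∞) ) < 0 and r₀'(x)·r₀(α) < 0 for every x ≥ α. Set γ₁⁺(α) := min{ |f(2r₀(α))|, |f(r₀(α) + r₀(+∞))| } and t_c := 1 / ( √(k(2r₀(α)))·|r₀'(α)|·γ₁⁺(α) ). Then any C¹ solution of the diagonal system ∂ₜr + k(r−ℓ)·∂ₓr = 0, ∂ₜℓ − k(r−ℓ)·∂ₓℓ = 0 with data r(0,·) = r₀, ℓ(0,·) = −r₀ on a strip [0,T)×ℝ, admitting C¹ forward and backward characteristic families (with continuous mixed second partials) and a C¹ intersection function β with x₁(t,α') = x₂(t, β(t,α')), must have T ≤ t_c; that is, the critical breakdown time t*(α) satisfies t*(α) ≤ 1/( √(k(2r₀(α)))·|r₀'(α)|·γ₁⁺(α) ). -/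

import Mathlib

open Filter

/-- The primitive `L` of the wave velocity `Q(ξ) = √(1+ξ²)` with `L 0 = 0`. -/
noncomputable def L (u : ℝ) : ℝ := (u * Real.sqrt (1 + u ^ 2) + Real.arsinh u) / 2

/-- The function `f(η) := k'(η)/√(k(η))`. -/
noncomputable def fk (k : ℝ → ℝ) (η : ℝ) : ℝ := deriv k η / Real.sqrt (k η)

open Set in
lemma aux_chain {F : ℝ → ℝ → ℝ} {y : ℝ → ℝ} {t y' : ℝ}
    (hF : DifferentiableAt ℝ (fun p : ℝ × ℝ => F p.1 p.2) (t, y t))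
    (hy : HasDerivAt y y' t) :
    HasDerivAt (fun s => F s (y s))
      (deriv (fun s => F s (y t)) t + deriv (fun x => F t x) (y t) * y') t := by
  have hd := hF.hasFDerivAt
  set D := fderiv ℝ (fun p : ℝ × ℝ => F p.1 p.2) (t, y t) with hD
  have h1 : HasDerivAt (fun s => F s (y t)) (D (1, 0)) t :=
    HasFDerivAt.comp_hasDerivAt (f := fun s : ℝ => (s, y t)) t hd
      ((hasDerivAt_id t).prodMk (hasDerivAt_const t (y t)))
  have h2 : HasDerivAt (fun x => F t x) (D (0, 1)) (y t) :=
    HasFDerivAt.comp_hasDerivAt (f := fun x : ℝ => (t, x)) (y t) hd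
      ((hasDerivAt_const (y t) t).prodMk (hasDerivAt_id (y t)))
  have h3 : HasDerivAt (fun s => F s (y s)) (D (1, y')) t :=
    HasFDerivAt.comp_hasDerivAt (f := fun s : ℝ => (s, y s)) t hd
      ((hasDerivAt_id t).prodMk hy)
  rw [h1.deriv, h2.deriv]
  have : D (1, y') = D (1, 0) + D (0, 1) * y' := by
    have e : ((1 : ℝ), y') = (1, 0) + y' • ((0 : ℝ), (1 : ℝ)) := by ext <;> simp
    rw [e, map_add, map_smul, smul_eq_mul, mul_comm]
  rwa [this] at h3

open Set in
lemma aux_diffAt {F : ℝ → ℝ → ℝ} {T : ℝ}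
    (hF : ContDiffOn ℝ 1 (fun p : ℝ × ℝ => F p.1 p.2) (Icc 0 T ×ˢ univ))
    {t : ℝ} (ht : t ∈ Ioo 0 T) (x : ℝ) :
    DifferentiableAt ℝ (fun p : ℝ × ℝ => F p.1 p.2) (t, x) := by
  refine (hF.differentiableOn one_ne_zero).differentiableAt ?_
  exact prod_mem_nhds (Icc_mem_nhds ht.1 ht.2) Filter.univ_mem

open Set in
lemma aux_part {F : ℝ → ℝ → ℝ} {T : ℝ} (hT : 0 < T)
    (hF : ContDiffOn ℝ 1 (fun p : ℝ × ℝ => F p.1 p.2) (Icc 0 T ×ˢ univ)) :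
    ContinuousOn (fun p : ℝ × ℝ => deriv (fun a => F p.1 a) p.2) (Icc 0 T ×ˢ univ) ∧
    ∀ t ∈ Icc 0 T, ∀ a, HasDerivAt (fun a => F t a) (deriv (fun a => F t a) a) a := by
  have hu : UniqueDiffOn ℝ (Icc 0 T ×ˢ (univ : Set ℝ)) :=
    (uniqueDiffOn_Icc hT).prod uniqueDiffOn_univ
  have key : ∀ t ∈ Icc 0 T, ∀ a, HasDerivAt (fun a => F t a)
      (fderivWithin ℝ (fun p : ℝ × ℝ => F p.1 p.2) (Icc 0 T ×ˢ univ) (t, a) (0, 1)) a := by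
    intro t ht a
    have hd := (hF.differentiableOn one_ne_zero (t, a) ⟨ht, mem_univ _⟩).hasFDerivWithinAt
    have := HasFDerivWithinAt.comp_hasDerivWithinAt (f := fun x : ℝ => (t, x)) (s := univ) a hd
      ((hasDerivAt_const a t).prodMk (hasDerivAt_id a)).hasDerivWithinAt
      (fun x _ => ⟨ht, mem_univ _⟩)
    exact hasDerivWithinAt_univ.1 this
  refine ⟨?_, fun t ht a => ?_⟩
  · have := (hF.continuousOn_fderivWithin hu le_rfl).clm_apply
      (continuousOn_const (c := ((0 : ℝ), (1 : ℝ))))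
    refine this.congr ?_
    rintro ⟨t, a⟩ hp
    exact (key t hp.1 a).deriv
  · rw [(key t ht a).deriv]; exact key t ht a

open Set in
lemma aux_const {g : ℝ → ℝ} {T : ℝ} (hc : ContinuousOn g (Icc 0 T))
    (hd : ∀ t ∈ Ioo 0 T, HasDerivAt g 0 t) : ∀ t ∈ Icc 0 T, g t = g 0 := by
  intro t ht
  rcases eq_or_lt_of_le ht.1 with h | h
  · rw [← h]
  · obtain ⟨c, hc1, hc2⟩ := exists_hasDerivAt_eq_slope g (fun _ => 0) h
      (hc.mono (Icc_subset_Icc le_rfl ht.2)) (fun x hx => hd x ⟨hx.1, hx.2.trans_le ht.2⟩)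
    have : t - 0 ≠ 0 := by linarith
    field_simp at hc2
    linarith

lemma L_hasDeriv (u : ℝ) : HasDerivAt L (Real.sqrt (1 + u ^ 2)) u := by
  have hpos : 0 < 1 + u ^ 2 := by positivity
  have h1 : HasDerivAt (fun u : ℝ => Real.sqrt (1 + u ^ 2)) (u / Real.sqrt (1 + u ^ 2)) u := by
    have : HasDerivAt (fun u : ℝ => 1 + u ^ 2) (2 * u) u := by
      simpa using (hasDerivAt_pow 2 u).const_add 1
    convert this.sqrt hpos.ne' using 1
    field_simp
  have h2 := (((hasDerivAt_id u).mul h1).add (Real.hasDerivAt_arsinh u)).div_const 2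
  have hs := Real.sq_sqrt hpos.le
  have hs' : 0 < Real.sqrt (1 + u ^ 2) := Real.sqrt_pos.2 hpos
  refine HasDerivAt.congr_deriv (f := L) h2 ?_
  simp only [id_eq]
  field_simp
  nlinarith

lemma L_neg (u : ℝ) : L (-u) = - L u := by
  unfold L; simp [Real.arsinh_neg]; ring

lemma L_ge {u : ℝ} (hu : 0 ≤ u) : u / 2 ≤ L u := by
  unfold L
  have h1 : 1 ≤ Real.sqrt (1 + u ^ 2) := Real.one_le_sqrt.2 (by nlinarith)
  have h2 : 0 ≤ Real.arsinh u := Real.arsinh_nonneg_iff.2 hu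
  nlinarith

lemma L_surj : Function.Surjective L := by
  refine Continuous.surjective
    (continuous_iff_continuousAt.2 fun u => (L_hasDeriv u).continuousAt) ?_ ?_
  · refine tendsto_atTop_mono' atTop ?_ (tendsto_id.atTop_div_const (by norm_num : (0:ℝ) < 2))
    filter_upwards [eventually_ge_atTop 0] with u hu using L_ge hu
  · refine tendsto_atBot_mono' atBot ?_ (tendsto_id.atBot_div_const (by norm_num : (0:ℝ) < 2))
    filter_upwards [eventually_le_atBot 0] with u hu
    have := L_ge (u := -u) (by linarith)
    rw [L_neg] at this
    simp only [id]; linarith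

lemma k_facts (k : ℝ → ℝ) (hk : ∀ u : ℝ, k (-(2 * L u)) = Real.sqrt (1 + u ^ 2))
    (hk1 : ContDiff ℝ 1 k) (η : ℝ) :
    1 ≤ k η ∧ (0 < η → 0 < deriv k η) ∧ (η < 0 → deriv k η < 0) ∧
      (fk k η) ^ 2 = (k η ^ 2 - 1) / (4 * k η ^ 5) := by
  obtain ⟨u, hu⟩ := L_surj (-(η / 2))
  have he : η = -(2 * L u) := by rw [hu]; ring
  have hpos : 0 < 1 + u ^ 2 := by positivity
  have hs := Real.sq_sqrt hpos.le
  have hs' : 0 < Real.sqrt (1 + u ^ 2) := Real.sqrt_pos.2 hpos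
  have hkη : k η = Real.sqrt (1 + u ^ 2) := by rw [he, hk]
  have hd : deriv k η = - u / (2 * (1 + u ^ 2)) := by
    have h1 : HasDerivAt (fun u : ℝ => Real.sqrt (1 + u ^ 2)) (u / Real.sqrt (1 + u ^ 2)) u := by
      have : HasDerivAt (fun u : ℝ => 1 + u ^ 2) (2 * u) u := by
        simpa using (hasDerivAt_pow 2 u).const_add 1
      convert this.sqrt hpos.ne' using 1
      field_simp
    have h2 : HasDerivAt (fun u => k (-(2 * L u)))
        (deriv k η * (-(2 * Real.sqrt (1 + u ^ 2)))) u := by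
      have hkd : HasDerivAt k (deriv k η) (-(2 * L u)) := by
        rw [← he]; exact ((hk1.differentiable one_ne_zero) η).hasDerivAt
      exact hkd.comp u (((L_hasDeriv u).const_mul 2).neg)
    have h3 := h2.unique (by simpa only [hk] using h1)
    rw [← hs]
    field_simp at h3 ⊢
    nlinarith
  have hone : 1 ≤ k η := by rw [hkη]; exact Real.one_le_sqrt.2 (by nlinarith)
  refine ⟨hone, ?_, ?_, ?_⟩
  · intro h
    have : u < 0 := by
      by_contra hc
      have := L_ge (not_lt.1 hc)
      linarith
    rw [hd]; apply div_pos <;> linarith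
  · intro h
    have : 0 < u := by
      by_contra hc
      have := L_ge (u := -u) (by linarith)
      rw [L_neg] at this
      linarith
    rw [hd]; apply div_neg_of_neg_of_pos <;> linarith
  · have h0 : 0 < k η := by linarith
    have hu2 : 1 + u ^ 2 = k η ^ 2 := by rw [hkη, hs]
    have hu3 : u ^ 2 = k η ^ 2 - 1 := by linarith
    rw [fk, div_pow, Real.sq_sqrt h0.le, hd, hu2, div_pow, neg_sq, hu3]
    field_simp
    ring

open Set in
lemma conv_aux {a b c m : ℝ} (ha : 1 ≤ a) (hb : 1 ≤ b) (hc : c ∈ uIcc a b) (hm : 0 ≤ m)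
    (h1 : m ≤ (a ^ 2 - 1) / (4 * a ^ 5)) (h2 : m ≤ (b ^ 2 - 1) / (4 * b ^ 5)) :
    m ≤ (c ^ 2 - 1) / (4 * c ^ 5) := by
  have h0 : ConvexOn ℝ (Ioi 0) (fun x : ℝ => (4 * m) • x ^ (3 : ℤ) + x ^ (-2 : ℤ)) :=
    ((convexOn_zpow 3).smul (by positivity)).add (convexOn_zpow (-2))
  have hcv := (h0.convex_le 1).ordConnected
  have key : ∀ x : ℝ, 0 < x → (m ≤ (x ^ 2 - 1) / (4 * x ^ 5) ↔
      (4 * m) • x ^ (3 : ℤ) + x ^ (-2 : ℤ) ≤ 1) := by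
    intro x hx
    have e : (4 * m) • x ^ (3 : ℤ) + x ^ (-2 : ℤ) = (4 * m * x ^ 5 + 1) / x ^ 2 := by
      rw [smul_eq_mul, zpow_neg]
      norm_cast
      field_simp
    rw [e, le_div_iff₀ (by positivity), div_le_one (by positivity)]
    constructor <;> intro h <;> linarith
  have ha' : 0 < a := by linarith
  have hb' : 0 < b := by linarith
  have := hcv.uIcc_subset ⟨ha', (key a ha').1 h1⟩ ⟨hb', (key b hb').1 h2⟩ hc
  exact (key c this.1).2 this.2

open Set in
lemma f_facts (k : ℝ → ℝ) (hk : ∀ u : ℝ, k (-(2 * L u)) = Real.sqrt (1 + u ^ 2))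
    (hk1 : ContDiff ℝ 1 k) {x y η : ℝ} (hη : η ∈ uIcc x y) (hxy : 0 < x * y) :
    min |fk k x| |fk k y| ≤ |fk k η| := by
  have hbet : k η ∈ uIcc (k x) (k y) := by
    rcases mul_pos_iff.1 hxy with ⟨hx, hy⟩ | ⟨hx, hy⟩
    · have hm : MonotoneOn k (Ici 0) := by
        refine monotoneOn_of_deriv_nonneg (convex_Ici 0) hk1.continuous.continuousOn
          (hk1.differentiable one_ne_zero).differentiableOn ?_
        intro z hz
        rw [interior_Ici] at hz
        exact ((k_facts k hk hk1 z).2.1 hz).le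
      exact (hm.mono (fun z hz => (le_min hx.le hy.le).trans hz.1)).mapsTo_uIcc hη
    · have hm : AntitoneOn k (Iic 0) := by
        refine antitoneOn_of_deriv_nonpos (convex_Iic 0) hk1.continuous.continuousOn
          (hk1.differentiable one_ne_zero).differentiableOn ?_
        intro z hz
        rw [interior_Iic] at hz
        exact ((k_facts k hk hk1 z).2.2.1 hz).le
      exact (hm.mono (fun z hz => hz.2.trans (max_le hx.le hy.le))).mapsTo_uIcc hη
  obtain ⟨a1, -, -, a4⟩ := k_facts k hk hk1 x
  obtain ⟨b1, -, -, b4⟩ := k_facts k hk hk1 y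
  obtain ⟨c1, -, -, c4⟩ := k_facts k hk hk1 η
  have hm0 : 0 ≤ min |fk k x| |fk k y| := le_min (abs_nonneg _) (abs_nonneg _)
  have := conv_aux (m := (min |fk k x| |fk k y|) ^ 2) a1 b1 hbet (by positivity)
    (by rw [← a4, ← sq_abs (fk k x)]; exact pow_le_pow_left₀ hm0 (min_le_left _ _) 2)
    (by rw [← b4, ← sq_abs (fk k y)]; exact pow_le_pow_left₀ hm0 (min_le_right _ _) 2)
  rw [← c4] at this
  have h := sq_le_sq.1 this
  rwa [abs_of_nonneg hm0] at h

open Set in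
lemma aux_swap {X G : ℝ → ℝ → ℝ} {T : ℝ} (hT : 0 < T)
    (hX : ContDiffOn ℝ 1 (fun p : ℝ × ℝ => X p.1 p.2) (Icc 0 T ×ˢ univ))
    (hG : ContDiffOn ℝ 1 (fun p : ℝ × ℝ => G p.1 p.2) (Icc 0 T ×ˢ univ))
    (hd : ∀ a, ∀ t ∈ Icc 0 T, HasDerivAt (fun s => X s a) (G t a) t) (α : ℝ) :
    ∀ t ∈ Ioo 0 T, HasDerivAt (fun s => deriv (fun a => X s a) α)
      (deriv (fun a => G t a) α) t := by
  obtain ⟨hGc, hGd⟩ := aux_part hT hG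
  obtain ⟨hXc, hXd⟩ := aux_part hT hX
  have hGs : ∀ a, ContinuousOn (fun s => G s a) (Icc 0 T) := fun a =>
    hG.continuousOn.comp (f := fun s : ℝ => (s, a)) (by fun_prop) (fun s hs => ⟨hs, mem_univ _⟩)
  have hGs' : ∀ a, ContinuousOn (fun s => deriv (fun a => G s a) a) (Icc 0 T) := fun a =>
    hGc.comp (f := fun s : ℝ => (s, a)) (by fun_prop) (fun s hs => ⟨hs, mem_univ _⟩)
  have hint : ∀ t ∈ Icc 0 T, ∀ a, X t a = X 0 a + ∫ s in (0:ℝ)..t, G s a := by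
    intro t ht a
    rw [intervalIntegral.integral_eq_sub_of_hasDerivAt (f := fun s => X s a)]
    · ring
    · intro s hs
      rw [uIcc_of_le ht.1] at hs
      exact hd a s ⟨hs.1, hs.2.trans ht.2⟩
    · refine ContinuousOn.intervalIntegrable ?_
      rw [uIcc_of_le ht.1]
      exact (hGs a).mono (Icc_subset_Icc le_rfl ht.2)
  obtain ⟨C, hC⟩ := (isCompact_Icc.prod (isCompact_Icc (a := α - 1) (b := α + 1))
    |>.bddAbove_image (f := fun p : ℝ × ℝ => ‖deriv (fun a => G p.1 a) p.2‖)
      ((hGc.mono (prod_mono_right (subset_univ _))).norm))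
  have hder : ∀ t ∈ Icc 0 T, deriv (fun a => X t a) α =
      deriv (fun a => X 0 a) α + ∫ s in (0:ℝ)..t, deriv (fun a => G s a) α := by
    intro t ht
    have hsub : uIoc 0 t ⊆ Icc 0 T := by
      rw [uIoc_of_le ht.1]; exact fun s hs => ⟨hs.1.le, hs.2.trans ht.2⟩
    have h := intervalIntegral.hasDerivAt_integral_of_dominated_loc_of_deriv_le
      (μ := MeasureTheory.volume) (a := 0) (b := t) (F := fun a s => G s a)
      (F' := fun a s => deriv (fun a => G s a) a) (x₀ := α) (s := Icc (α - 1) (α + 1))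
      (bound := fun _ => C) (Icc_mem_nhds (by linarith) (by linarith))
      (Eventually.of_forall fun a =>
        ((hGs a).mono hsub).aestronglyMeasurable measurableSet_uIoc)
      (ContinuousOn.intervalIntegrable (by
        rw [uIcc_of_le ht.1]
        exact (hGs α).mono (Icc_subset_Icc le_rfl ht.2)))
      (((hGs' α).mono hsub).aestronglyMeasurable measurableSet_uIoc)
      (Eventually.of_forall fun s hs a ha => hC ⟨(s, a), ⟨hsub hs, ha⟩, rfl⟩)
      intervalIntegrable_const
      (Eventually.of_forall fun s hs a ha => hGd s (hsub hs) a)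
    have h2 := (hXd 0 ⟨le_rfl, hT.le⟩ α).add h.2
    have h3 : (fun a => X t a) = (fun a => X 0 a) + fun a => ∫ s in (0:ℝ)..t, G s a := by
      funext a; exact hint t ht a
    rw [← h3] at h2
    exact h2.deriv
  intro t ht
  have hF : HasDerivAt (fun t => deriv (fun a => X 0 a) α +
      ∫ s in (0:ℝ)..t, deriv (fun a => G s a) α) (deriv (fun a => G t a) α) t := by
    refine HasDerivAt.const_add _ ?_
    refine intervalIntegral.integral_hasDerivAt_right ?_ ?_ ?_
    · refine ContinuousOn.intervalIntegrable ?_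
      rw [uIcc_of_le ht.1.le]
      exact (hGs' α).mono (Icc_subset_Icc le_rfl ht.2.le)
    · exact ((hGs' α).mono Ioo_subset_Icc_self).stronglyMeasurableAtFilter isOpen_Ioo t ht
    · exact (hGs' α).continuousAt (Icc_mem_nhds ht.1 ht.2)
  refine hF.congr_of_eventuallyEq ?_
  filter_upwards [Icc_mem_nhds ht.1 ht.2] with s hs using hder s hs

open Set in
lemma aux_pos {g : ℝ → ℝ} {T : ℝ} (hc : ContinuousOn g (Icc 0 T))
    (h0 : 0 < g 0) (hne : ∀ t ∈ Icc 0 T, g t ≠ 0) : ∀ t ∈ Icc 0 T, 0 < g t := by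
  intro t ht
  by_contra hcon
  obtain ⟨c, hc1, hc2⟩ := intermediate_value_Icc' ht.1 (hc.mono (Icc_subset_Icc le_rfl ht.2))
    (show (0:ℝ) ∈ Icc (g t) (g 0) from ⟨not_lt.1 hcon, h0.le⟩)
  exact hne c ⟨hc1.1, hc1.2.trans ht.2⟩ hc2

open Set in
lemma aux_main
    (k : ℝ → ℝ) (hkpos : ∀ η, 0 < k η)
    (hk1 : ContDiff ℝ 1 k)
    (r₀ : ℝ → ℝ) (hr₀ : ContDiff ℝ 1 r₀)
    (α : ℝ) (hα : deriv r₀ α ≠ 0)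
    (T : ℝ) (hT : 0 < T)
    (r l x₁ x₂ B : ℝ → ℝ → ℝ)
    (hr : ContDiffOn ℝ 1 (fun p : ℝ × ℝ => r p.1 p.2) (Icc 0 T ×ˢ univ))
    (hl : ContDiffOn ℝ 1 (fun p : ℝ × ℝ => l p.1 p.2) (Icc 0 T ×ˢ univ))
    (hsys : ∀ t x : ℝ, t ∈ Icc 0 T →
      deriv (fun s => r s x) t + k (r t x - l t x) * deriv (fun y => r t y) x = 0 ∧
      deriv (fun s => l s x) t - k (r t x - l t x) * deriv (fun y => l t y) x = 0)
    (hir : ∀ x, r 0 x = r₀ x) (hil : ∀ x, l 0 x = -(r₀ x))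
    (hx₁ode : ∀ (a t : ℝ), t ∈ Icc 0 T →
      HasDerivAt (fun s => x₁ s a) (k (r t (x₁ t a) - l t (x₁ t a))) t)
    (hx₁0 : ∀ a, x₁ 0 a = a)
    (hx₂ode : ∀ (b t : ℝ), t ∈ Icc 0 T →
      HasDerivAt (fun s => x₂ s b) (-(k (r t (x₂ t b) - l t (x₂ t b)))) t)
    (hx₂0 : ∀ b, x₂ 0 b = b)
    (hx₁C : ContDiffOn ℝ 1 (fun p : ℝ × ℝ => x₁ p.1 p.2) (Icc 0 T ×ˢ univ))
    (hx₂C : ContDiffOn ℝ 1 (fun p : ℝ × ℝ => x₂ p.1 p.2) (Icc 0 T ×ˢ univ))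
    (hB : ContDiffOn ℝ 1 (fun p : ℝ × ℝ => B p.1 p.2) (Icc 0 T ×ˢ univ))
    (hBint : ∀ (t a : ℝ), t ∈ Icc 0 T → x₁ t a = x₂ t (B t a)) :
    ∃ β z : ℝ → ℝ, ContinuousOn z (Icc 0 T) ∧ z 0 = 1 / Real.sqrt (k (2 * r₀ α)) ∧
      (∀ t ∈ Icc 0 T, 0 < z t) ∧ ∀ t ∈ Ioo 0 T, α ≤ β t ∧
        HasDerivAt z (deriv r₀ α * fk k (r₀ α + r₀ (β t))) t := by
  have hsl : ∀ {F : ℝ × ℝ → ℝ} (y : ℝ → ℝ), ContinuousOn F (Icc 0 T ×ˢ univ) →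
      ContinuousOn y (Icc 0 T) → ContinuousOn (fun s => F (s, y s)) (Icc 0 T) :=
    fun {F} y hF hy => hF.comp (f := fun s : ℝ => (s, y s)) (by fun_prop)
      (fun s hs => ⟨hs, mem_univ _⟩)
  have h0T : (0:ℝ) ∈ Icc 0 T := ⟨le_rfl, hT.le⟩
  have hI : ∀ t ∈ Ioo 0 T, t ∈ Icc 0 T := fun t h => Ioo_subset_Icc_self h
  -- invariance
  have hrc : ∀ a, ∀ t ∈ Icc 0 T, r t (x₁ t a) = r₀ a := by
    intro a t ht
    have hc1 : ContinuousOn (fun s => x₁ s a) (Icc 0 T) :=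
      hsl (fun _ => a) hx₁C.continuousOn continuousOn_const
    have := aux_const (g := fun s => r s (x₁ s a)) (hsl _ hr.continuousOn hc1) (by
      intro s hs
      have h := aux_chain (y := fun s => x₁ s a) (aux_diffAt hr hs (x₁ s a))
        (hx₁ode a s (hI s hs))
      convert h using 1
      have := (hsys s (x₁ s a) (hI s hs)).1
      linarith) t ht
    simp only [hx₁0, hir] at this
    exact this
  have hlc : ∀ b, ∀ t ∈ Icc 0 T, l t (x₂ t b) = - r₀ b := by
    intro a t ht
    have hc1 : ContinuousOn (fun s => x₂ s a) (Icc 0 T) :=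
      hsl (fun _ => a) hx₂C.continuousOn continuousOn_const
    have := aux_const (g := fun s => l s (x₂ s a)) (hsl _ hl.continuousOn hc1) (by
      intro s hs
      have h := aux_chain (y := fun s => x₂ s a) (aux_diffAt hl hs (x₂ s a))
        (hx₂ode a s (hI s hs))
      convert h using 1
      have := (hsys s (x₂ s a) (hI s hs)).2
      linarith) t ht
    simp only [hx₂0, hil] at this
    exact this
  have hspeed : ∀ a, ∀ t ∈ Icc 0 T,
      r t (x₁ t a) - l t (x₁ t a) = r₀ a + r₀ (B t a) := by
    intro a t ht
    rw [hrc a t ht, hBint t a ht, hlc _ t ht]; ring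
  obtain ⟨hx₁c, hx₁d⟩ := aux_part hT hx₁C
  obtain ⟨hx₂c, hx₂d⟩ := aux_part hT hx₂C
  obtain ⟨-, hBd⟩ := aux_part hT hB
  obtain ⟨-, hrd⟩ := aux_part hT hr
  have hr₀d : ∀ x, HasDerivAt r₀ (deriv r₀ x) x := fun x =>
    (hr₀.differentiable one_ne_zero x).hasDerivAt
  have hkd : ∀ x, HasDerivAt k (deriv k x) x := fun x =>
    (hk1.differentiable one_ne_zero x).hasDerivAt
  have hB0 : B 0 α = α := by
    have := hBint 0 α h0T
    rw [hx₁0, hx₂0] at this; exact this.symm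
  set β : ℝ → ℝ := fun t => B t α with hβ
  set w : ℝ → ℝ := fun t => deriv (fun a => x₁ t a) α with hw
  set p : ℝ → ℝ := fun t => deriv (fun b => x₂ t b) (β t) with hp
  have hβc : ContinuousOn β (Icc 0 T) := hsl (fun _ => α) hB.continuousOn continuousOn_const
  have hwc : ContinuousOn w (Icc 0 T) := hsl (fun _ => α) hx₁c continuousOn_const
  have hpc : ContinuousOn p (Icc 0 T) := hsl β hx₂c hβc
  have hw0 : w 0 = 1 := by simp [hw, hx₁0]
  have hp0 : p 0 = 1 := by simp [hp, hx₂0]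
  -- positivity of w
  have hwne : ∀ t ∈ Icc 0 T, w t ≠ 0 := by
    intro t ht h0
    have h1 := (hrd t ht (x₁ t α)).comp α (hx₁d t ht α)
    have h2 : ((fun a => r t a) ∘ fun a => x₁ t a) = r₀ := by
      funext a; exact hrc a t ht
    rw [h2] at h1
    have h3 := h1.unique (hr₀d α)
    have h4 : deriv (fun a => x₁ t a) α = 0 := h0
    rw [h4, mul_zero] at h3
    exact hα h3.symm
  have hwpos := aux_pos hwc (by rw [hw0]; norm_num) hwne
  -- derivative of β
  have hβd : ∀ t ∈ Ioo 0 T, ∃ β', HasDerivAt β β' t ∧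
      β' * p t = 2 * k (r₀ α + r₀ (β t)) := by
    intro t ht
    have hBD : HasDerivAt β (deriv β t) t := by
      have := (aux_diffAt hB ht α).comp (f := fun s : ℝ => (s, α)) t
        (differentiableAt_id.prodMk (differentiableAt_const α))
      exact DifferentiableAt.hasDerivAt this
    refine ⟨deriv β t, hBD, ?_⟩
    have h1 := aux_chain (y := β) (aux_diffAt hx₂C ht (β t)) hBD
    have h2 : HasDerivAt (fun s => x₂ s (β s)) (k (r t (x₁ t α) - l t (x₁ t α))) t := by
      refine (hx₁ode α t (hI t ht)).congr_of_eventuallyEq ?_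
      filter_upwards [Icc_mem_nhds ht.1 ht.2] with s hs using (hBint s α hs).symm
    have h3 := h1.unique h2
    have h4 : x₂ t (β t) = x₁ t α := (hBint t α (hI t ht)).symm
    rw [(hx₂ode (β t) t (hI t ht)).deriv, h4, hspeed α t (hI t ht)] at h3
    simp only [hp, hβ] at h3 ⊢
    linarith
  have hwp : ∀ t ∈ Icc 0 T, p t * deriv (fun a => B t a) α = w t := by
    intro t ht
    have h1 := (hx₂d t ht (β t)).comp α (hBd t ht α)
    have h2 : ((fun b => x₂ t b) ∘ fun a => B t a) = fun a => x₁ t a := by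
      funext a; exact (hBint t a ht).symm
    rw [h2] at h1
    exact h1.unique (hx₁d t ht α)
  have hpne : ∀ t ∈ Icc 0 T, p t ≠ 0 := by
    intro t ht h0
    have := hwp t ht
    rw [h0, zero_mul] at this
    exact hwne t ht this.symm
  have hppos := aux_pos hpc (by rw [hp0]; norm_num) hpne
  have hβmono : MonotoneOn β (Icc 0 T) := by
    refine monotoneOn_of_deriv_nonneg (convex_Icc 0 T) hβc ?_ ?_
    · rw [interior_Icc]
      intro t ht
      obtain ⟨b, hb, -⟩ := hβd t ht
      exact hb.differentiableAt.differentiableWithinAt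
    · rw [interior_Icc]
      intro t ht
      obtain ⟨b, hb, hb2⟩ := hβd t ht
      rw [hb.deriv]
      have h1 := hppos t (hI t ht)
      have h2 := hkpos (r₀ α + r₀ (β t))
      by_contra hneg
      nlinarith
  -- derivative of w
  have hGC : ContDiffOn ℝ 1 (fun q : ℝ × ℝ => k (r₀ q.2 + r₀ (B q.1 q.2)))
      (Icc 0 T ×ˢ univ) :=
    hk1.comp_contDiffOn (((hr₀.comp contDiff_snd).contDiffOn).add (hr₀.comp_contDiffOn hB))
  have hwd := aux_swap (X := x₁) (G := fun t a => k (r₀ a + r₀ (B t a))) hT hx₁C hGC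
    (by
      intro a t ht
      have := hx₁ode a t ht
      rwa [hspeed a t ht] at this) α
  refine ⟨β, fun t => w t / Real.sqrt (k (r₀ α + r₀ (β t))), ?_, ?_, ?_, ?_⟩
  · refine hwc.div ?_ (fun t _ => (Real.sqrt_pos.2 (hkpos _)).ne')
    exact (Real.continuous_sqrt.comp hk1.continuous).comp_continuousOn
      (continuousOn_const.add (hr₀.continuous.comp_continuousOn hβc))
  · have : β 0 = α := hB0
    simp only [hw0, this, two_mul]
  · intro t ht
    exact div_pos (hwpos t ht) (Real.sqrt_pos.2 (hkpos _))
  · intro t ht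
    have hle : α ≤ β t := by
      have := hβmono h0T (hI t ht) ht.1.le
      have h0 : β 0 = α := hB0
      rwa [h0] at this
    refine ⟨hle, ?_⟩
    obtain ⟨b, hb, hb2⟩ := hβd t ht
    have hη : HasDerivAt (fun s => r₀ α + r₀ (β s)) (deriv r₀ (β t) * b) t :=
      ((hr₀d (β t)).comp t hb).const_add _
    have hkη : HasDerivAt (fun s => k (r₀ α + r₀ (β s)))
        (deriv k (r₀ α + r₀ (β t)) * (deriv r₀ (β t) * b)) t :=
      (hkd (r₀ α + r₀ (β t))).comp t hη
    have hsq := hkη.sqrt (hkpos _).ne'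
    have hG : HasDerivAt (fun a => k (r₀ a + r₀ (B t a)))
        (deriv k (r₀ α + r₀ (β t)) *
          (deriv r₀ α + deriv r₀ (β t) * deriv (fun a => B t a) α)) α :=
      (hkd (r₀ α + r₀ (β t))).comp α
        ((hr₀d α).add ((hr₀d (β t)).comp α (hBd t (hI t ht) α)))
    have hwt := hwd t ht
    rw [hG.deriv] at hwt
    have hspos := Real.sqrt_pos.2 (hkpos (r₀ α + r₀ (β t)))
    have hz := hwt.div hsq hspos.ne'
    refine HasDerivAt.congr_deriv hz ?_
    have hs2 := Real.sq_sqrt (hkpos (r₀ α + r₀ (β t))).le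
    have hwp' := hwp t (hI t ht)
    rw [fk]
    rw [← hs2] at hb2
    have hwp2 : deriv (fun a => x₁ t a) α = p t * deriv (fun a => B t a) α := hwp'.symm
    rw [hwp2]
    generalize Real.sqrt (k (r₀ α + r₀ (β t))) = S at *
    generalize deriv k (r₀ α + r₀ (β t)) = K at *
    generalize deriv (fun a => B t a) α = D at *
    field_simp
    linear_combination (-(D * K * deriv r₀ (β t))) * hb2

/-- first critical-time estimate: if `r₀'(α)(r₀(α)+r₀(+∞)) < 0` and
`r₀'(x)·r₀(α) < 0` for all `x ≥ α`, then any C¹ solution of the diagonal system on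
`[0,T)×ℝ` (with C¹ characteristic families and intersection function) has
`T ≤ 1/(√(k(2r₀(α)))·|r₀'(α)|·γ₁⁺(α))` with
`γ₁⁺(α) = min {|f(2r₀(α))|, |f(r₀(α)+r₀(+∞))|}`. -/
theorem critical_time_estimate_first
    (k : ℝ → ℝ) (hk : ∀ u : ℝ, k (-(2 * L u)) = Real.sqrt (1 + u ^ 2))
    (hk1 : ContDiff ℝ 1 k)
    (r₀ : ℝ → ℝ) (hr₀ : ContDiff ℝ 1 r₀)
    (hr₀b : ∃ C : ℝ, ∀ x, |r₀ x| ≤ C) (hr₀'b : ∃ C : ℝ, ∀ x, |deriv r₀ x| ≤ C)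
    (rp : ℝ) (hrp : Tendsto r₀ atTop (nhds rp))
    (α : ℝ) (hα : deriv r₀ α * (r₀ α + rp) < 0)
    (hsign : ∀ x : ℝ, α ≤ x → deriv r₀ x * r₀ α < 0)
    (T : EReal) (hT : 0 < T)
    (r l x₁ x₂ B : ℝ → ℝ → ℝ)
    (hrl : ContDiffOn ℝ 1 (fun p : ℝ × ℝ => (r p.1 p.2, l p.1 p.2))
      {p : ℝ × ℝ | 0 ≤ p.1 ∧ (p.1 : EReal) < T})
    (hsys : ∀ t x : ℝ, 0 ≤ t → (t : EReal) < T →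
      deriv (fun s => r s x) t + k (r t x - l t x) * deriv (fun y => r t y) x = 0 ∧
      deriv (fun s => l s x) t - k (r t x - l t x) * deriv (fun y => l t y) x = 0)
    (hir : ∀ x, r 0 x = r₀ x) (hil : ∀ x, l 0 x = -(r₀ x))
    (hx₁ode : ∀ (a t : ℝ), 0 ≤ t → (t : EReal) < T →
      HasDerivAt (fun s => x₁ s a) (k (r t (x₁ t a) - l t (x₁ t a))) t)
    (hx₁0 : ∀ a, x₁ 0 a = a)
    (hx₂ode : ∀ (b t : ℝ), 0 ≤ t → (t : EReal) < T →
      HasDerivAt (fun s => x₂ s b) (-(k (r t (x₂ t b) - l t (x₂ t b)))) t)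
    (hx₂0 : ∀ b, x₂ 0 b = b)
    (hx₁C : ContDiffOn ℝ 1 (fun p : ℝ × ℝ => x₁ p.1 p.2)
      {p : ℝ × ℝ | 0 ≤ p.1 ∧ (p.1 : EReal) < T})
    (hx₂C : ContDiffOn ℝ 1 (fun p : ℝ × ℝ => x₂ p.1 p.2)
      {p : ℝ × ℝ | 0 ≤ p.1 ∧ (p.1 : EReal) < T})
    (hx₁mix : ContinuousOn
      (fun p : ℝ × ℝ => deriv (fun s => deriv (fun a => x₁ s a) p.2) p.1)
      {p : ℝ × ℝ | 0 ≤ p.1 ∧ (p.1 : EReal) < T})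
    (hx₂mix : ContinuousOn
      (fun p : ℝ × ℝ => deriv (fun s => deriv (fun b => x₂ s b) p.2) p.1)
      {p : ℝ × ℝ | 0 ≤ p.1 ∧ (p.1 : EReal) < T})
    (hB : ContDiffOn ℝ 1 (fun p : ℝ × ℝ => B p.1 p.2)
      {p : ℝ × ℝ | 0 ≤ p.1 ∧ (p.1 : EReal) < T})
    (hBint : ∀ (t a : ℝ), 0 ≤ t → (t : EReal) < T → x₁ t a = x₂ t (B t a)) :
    T ≤ ((1 / (Real.sqrt (k (2 * r₀ α)) * |deriv r₀ α| *
      min |fk k (2 * r₀ α)| |fk k (r₀ α + rp)|) : ℝ) : EReal) := by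
  have hkf := k_facts k hk hk1
  have hkpos : ∀ η, 0 < k η := fun η => by have := (hkf η).1; linarith
  have hsα := hsign α le_rfl
  have hA : deriv r₀ α ≠ 0 := by
    intro h; rw [h, zero_mul] at hsα; exact lt_irrefl _ hsα
  have hR : r₀ α ≠ 0 := by
    intro h; rw [h, mul_zero] at hsα; exact lt_irrefl _ hsα
  have hprod : 0 < (2 * r₀ α) * (r₀ α + rp) := by
    have h1 := mul_pos_of_neg_of_neg hsα hα
    have h2 : 0 < deriv r₀ α ^ 2 := by positivity
    have h3 : 0 < deriv r₀ α ^ 2 * (r₀ α * (r₀ α + rp)) := by nlinarith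
    have := (mul_pos_iff_of_pos_left h2).1 h3
    linarith
  have hfne : ∀ η, η ≠ 0 → 0 < |fk k η| := by
    intro η hη
    refine abs_pos.2 (div_ne_zero ?_ (Real.sqrt_pos.2 (hkpos η)).ne')
    rcases lt_or_gt_of_ne hη with h | h
    · exact ((hkf η).2.2.1 h).ne
    · exact ((hkf η).2.1 h).ne'
  set γ := min |fk k (2 * r₀ α)| |fk k (r₀ α + rp)| with hγ
  have hγpos : 0 < γ := lt_min (hfne _ (left_ne_zero_of_mul hprod.ne'))
    (hfne _ (right_ne_zero_of_mul hprod.ne'))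
  -- the range of η
  have hrange : ∀ b, α ≤ b → r₀ α + r₀ b ∈ Set.uIcc (2 * r₀ α) (r₀ α + rp) ∧
      deriv r₀ α * fk k (r₀ α + r₀ b) ≤ -(|deriv r₀ α| * γ) := by
    intro b hb
    have hmem : r₀ α + r₀ b ∈ Set.uIcc (2 * r₀ α) (r₀ α + rp) := by
      rcases lt_or_gt_of_ne hR with h | h
      · have hm : MonotoneOn r₀ (Set.Ici α) := by
          refine monotoneOn_of_deriv_nonneg (convex_Ici α) hr₀.continuous.continuousOn
            (hr₀.differentiable one_ne_zero).differentiableOn ?_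
          intro x hx
          rw [interior_Ici] at hx
          have := hsign x (le_of_lt hx)
          by_contra hc
          nlinarith
        have h1 := hm (Set.mem_Ici.2 le_rfl) (Set.mem_Ici.2 hb) hb
        have h2 : r₀ b ≤ rp := ge_of_tendsto hrp (by
          filter_upwards [eventually_ge_atTop b] with x hx
          exact hm (Set.mem_Ici.2 hb) (Set.mem_Ici.2 (hb.trans hx)) hx)
        exact Set.mem_uIcc.2 (Or.inl ⟨by linarith, by linarith⟩)
      · have hm : AntitoneOn r₀ (Set.Ici α) := by
          refine antitoneOn_of_deriv_nonpos (convex_Ici α) hr₀.continuous.continuousOn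
            (hr₀.differentiable one_ne_zero).differentiableOn ?_
          intro x hx
          rw [interior_Ici] at hx
          have := hsign x (le_of_lt hx)
          by_contra hc
          nlinarith
        have h1 := hm (Set.mem_Ici.2 le_rfl) (Set.mem_Ici.2 hb) hb
        have h2 : rp ≤ r₀ b := le_of_tendsto hrp (by
          filter_upwards [eventually_ge_atTop b] with x hx
          exact hm (Set.mem_Ici.2 hb) (Set.mem_Ici.2 (hb.trans hx)) hx)
        exact Set.mem_uIcc.2 (Or.inr ⟨by linarith, by linarith⟩)
    refine ⟨hmem, ?_⟩
    have hge : γ ≤ |fk k (r₀ α + r₀ b)| := f_facts k hk hk1 hmem hprod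
    have hneg : deriv r₀ α * fk k (r₀ α + r₀ b) ≤ 0 := by
      have hs := Real.sqrt_pos.2 (hkpos (r₀ α + r₀ b))
      rcases Set.mem_uIcc.1 hmem with ⟨m1, m2⟩ | ⟨m1, m2⟩ <;>
      rcases mul_pos_iff.1 hprod with ⟨q1, q2⟩ | ⟨q1, q2⟩
      all_goals first
        | (have hη : 0 < r₀ α + r₀ b := by linarith
           have hd := (hkf _).2.1 hη
           have hA' : deriv r₀ α ≤ 0 := by
             by_contra hc
             nlinarith
           exact mul_nonpos_of_nonpos_of_nonneg hA' (div_pos hd hs).le)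
        | (have hη : r₀ α + r₀ b < 0 := by linarith
           have hd := (hkf _).2.2.1 hη
           have hA' : 0 ≤ deriv r₀ α := by
             by_contra hc
             nlinarith
           exact mul_nonpos_of_nonneg_of_nonpos hA' (div_neg_of_neg_of_pos hd hs).le)
    have habs := abs_of_nonpos hneg
    rw [abs_mul] at habs
    have := mul_le_mul_of_nonneg_left hge (abs_nonneg (deriv r₀ α))
    linarith
  by_contra hcon
  rw [not_le] at hcon
  set S := Real.sqrt (k (2 * r₀ α)) with hS
  have hSpos : 0 < S := Real.sqrt_pos.2 (hkpos _)
  have hApos : 0 < |deriv r₀ α| := abs_pos.2 hA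
  obtain ⟨T', hT1, hT2⟩ := EReal.lt_iff_exists_real_btwn.1 hcon
  rw [EReal.coe_lt_coe_iff] at hT1
  have htc : 0 < 1 / (S * |deriv r₀ α| * γ) := by positivity
  have hT'0 : 0 < T' := htc.trans hT1
  have hlt : ∀ t ∈ Set.Icc 0 T', 0 ≤ t ∧ (t : EReal) < T := fun t ht =>
    ⟨ht.1, lt_of_le_of_lt (EReal.coe_le_coe_iff.2 ht.2) hT2⟩
  have hsub : Set.Icc 0 T' ×ˢ (Set.univ : Set ℝ) ⊆
      {p : ℝ × ℝ | 0 ≤ p.1 ∧ (p.1 : EReal) < T} := fun p hp => hlt p.1 hp.1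
  obtain ⟨β, z, hzc, hz0, hzpos, hzd⟩ := aux_main k hkpos hk1 r₀ hr₀ α hA T' hT'0 r l x₁ x₂ B
    (hrl.fst.mono hsub) (hrl.snd.mono hsub)
    (fun t x ht => hsys t x (hlt t ht).1 (hlt t ht).2) hir hil
    (fun a t ht => hx₁ode a t (hlt t ht).1 (hlt t ht).2) hx₁0
    (fun a t ht => hx₂ode a t (hlt t ht).1 (hlt t ht).2) hx₂0
    (hx₁C.mono hsub) (hx₂C.mono hsub) (hB.mono hsub)
    (fun t a ht => hBint t a (hlt t ht).1 (hlt t ht).2)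
  obtain ⟨c, hc1, hc2⟩ := exists_hasDerivAt_eq_slope z
    (fun t => deriv r₀ α * fk k (r₀ α + r₀ (β t))) hT'0 hzc (fun x hx => (hzd x hx).2)
  have h1 := (hrange (β c) (hzd c hc1).1).2
  rw [hc2, sub_zero, div_le_iff₀ hT'0] at h1
  have h2 := hzpos T' ⟨hT'0.le, le_rfl⟩
  rw [hz0] at h1
  rw [div_lt_iff₀ (by positivity)] at hT1
  have h3 : 1 / S < |deriv r₀ α| * γ * T' := by
    rw [div_lt_iff₀ hSpos]; linarith
  linarith
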